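/- Let Ω₁, Ω₂ ⊂ ℂ^N be bounded domains with C²-smooth boundaries and let f be a biholomorphism of Ω₁ onto Ω₂ extending to a biholomorphism between neighborhoods of their closures. Then there exist constants 0 < c < C such that for all z, w ∈ Ω₁: c ≤ [‖(f(z)−f(w))_{f(z)}‖ + ‖f(z)−f(w)‖² + δ_{Ω₂}(f(z))^{1/2}·‖f(z)−f(w)‖] / [‖(z−w)_z‖ + ‖z−w‖² + δ_{Ω₁}(z)^{1/2}·‖z−w‖] ≤ C (for z ≠ w). -/

import Mathlib

open Metric Set Filter Topology MeasureTheory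

noncomputable section

namespace InvDist

/-- Complex Euclidean `N`-space. -/
abbrev E (N : ℕ) := EuclideanSpace ℂ (Fin N)

variable {N : ℕ}

/-- The paper's Hermitian product `⟨a,b⟩ = ∑ a_j * conj (b_j)`. -/
def herm (a b : E N) : ℂ := ∑ j, a j * (starRingEnd ℂ) (b j)

/-- Euclidean distance to the boundary of `Ω`. -/
def bdist (Ω : Set (E N)) (x : E N) : ℝ := Metric.infDist x (frontier Ω)

/-- `π` selects, for each point of `Ω`, a closest point on the boundary. -/
def IsClosestPointSelection (Ω : Set (E N)) (π : E N → E N) : Prop :=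
  ∀ z ∈ Ω, π z ∈ frontier Ω ∧ dist z (π z) = bdist Ω z

/-- `‖v_z‖`: modulus of the complex normal component of `v` with respect to the
closest boundary point `π z`; the outer unit normal at `π z` is `(π z - z)/‖π z - z‖`. -/
def ncomp (Ω : Set (E N)) (π : E N → E N) (z v : E N) : ℝ :=
  ‖herm v (π z - z)‖ / bdist Ω z

/-- `‖v_z^ℝ‖`: modulus of the real normal component of `v` at `π z`. -/
def ncompR (Ω : Set (E N)) (π : E N → E N) (z v : E N) : ℝ :=
  |(herm v (π z - z)).re| / bdist Ω z

/-- The quantity `A_Ω(z,w)`. -/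
def Afun (Ω : Set (E N)) (π : E N → E N) (z w : E N) : ℝ :=
  (ncomp Ω π z (z - w) + ‖z - w‖ ^ 2 + ‖z - w‖ * Real.sqrt (bdist Ω z)) /
    (Real.sqrt (bdist Ω z) * Real.sqrt (bdist Ω w))

/-- `h_Ω(z,w) = ‖(z-w)_z‖ + ‖z-w‖ δ_Ω(z)^{1/2}`. -/
def hfun (Ω : Set (E N)) (π : E N → E N) (z w : E N) : ℝ :=
  ncomp Ω π z (z - w) + ‖z - w‖ * Real.sqrt (bdist Ω z)

/-- real analogue of `h_Ω`. -/
def hfunR (Ω : Set (E N)) (π : E N → E N) (z w : E N) : ℝ :=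
  ncompR Ω π z (z - w) + ‖z - w‖ * Real.sqrt (bdist Ω z)

/-- inverse hyperbolic tangent -/
def artanh (x : ℝ) : ℝ := Real.log ((1 + x) / (1 - x)) / 2

/-- The Lempert function of `Ω`. -/
def lempert (Ω : Set (E N)) (z w : E N) : ℝ :=
  artanh (sInf { r : ℝ | ∃ φ : ℂ → E N, DifferentiableOn ℂ φ (ball 0 1) ∧
    MapsTo φ (ball (0:ℂ) 1) Ω ∧ φ 0 = z ∧ ∃ a ∈ ball (0:ℂ) 1, φ a = w ∧ r = ‖a‖ })

/-- The Carathéodory distance of `Ω`. -/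
def caratheodory (Ω : Set (E N)) (z w : E N) : ℝ :=
  artanh (sSup { r : ℝ | ∃ f : E N → ℂ, DifferentiableOn ℂ f Ω ∧
    MapsTo f Ω (ball (0:ℂ) 1) ∧ f z = 0 ∧ r = ‖f w‖ })

/-- The Kobayashi distance: the largest pseudodistance not exceeding the Lempert
function, given as an infimum over chains. -/
def kobayashi (Ω : Set (E N)) (z w : E N) : ℝ :=
  sInf { r : ℝ | ∃ (n : ℕ) (p : Fin (n + 1) → E N), p 0 = z ∧ p (Fin.last n) = w ∧
    (∀ i, p i ∈ Ω) ∧ r = ∑ i : Fin n, lempert Ω (p i.castSucc) (p i.succ) }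

/-- The Poincaré distance on the unit disc. -/
def poincare (ζ ξ : ℂ) : ℝ := artanh ‖(ζ - ξ) / (1 - (starRingEnd ℂ) ζ * ξ)‖

/-- A complex geodesic of `Ω`. -/
def IsComplexGeodesic (Ω : Set (E N)) (φ : ℂ → E N) : Prop :=
  DifferentiableOn ℂ φ (ball 0 1) ∧ MapsTo φ (ball (0:ℂ) 1) Ω ∧
    ∀ ζ ∈ ball (0:ℂ) 1, ∀ ξ ∈ ball (0:ℂ) 1, kobayashi Ω (φ ζ) (φ ξ) = poincare ζ ξ

/-- `ρ` is `C^k` on `U` with `α`-Hölder `k`-th derivative. -/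
def IsCkHolderOn (k : ℕ) (α : ℝ) (ρ : E N → ℝ) (U : Set (E N)) : Prop :=
  ContDiffOn ℝ k ρ U ∧ ∃ M : ℝ, ∀ x ∈ U, ∀ y ∈ U,
    ‖iteratedFDeriv ℝ k ρ x - iteratedFDeriv ℝ k ρ y‖ ≤ M * ‖x - y‖ ^ α

/-- The Levi form of `ρ` at `p` evaluated at `v`. -/
def levi (ρ : E N → ℝ) (p v : E N) : ℝ :=
  (iteratedFDeriv ℝ 2 ρ p ![v, v] +
    iteratedFDeriv ℝ 2 ρ p ![(Complex.I : ℂ) • v, (Complex.I : ℂ) • v]) / 4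

/-- Bounded strongly pseudoconvex domain with `C^{k,α}`-smooth boundary. -/
def IsStronglyPseudoconvexDomain (k : ℕ) (α : ℝ) (Ω : Set (E N)) : Prop :=
  IsOpen Ω ∧ IsConnected Ω ∧ Bornology.IsBounded Ω ∧
  ∃ (U : Set (E N)) (ρ : E N → ℝ), IsOpen U ∧ closure Ω ⊆ U ∧
    IsCkHolderOn k α ρ U ∧ Ω = {x ∈ U | ρ x < 0} ∧
    (∀ p ∈ frontier Ω, fderiv ℝ ρ p ≠ 0) ∧
    ∀ p ∈ frontier Ω, ∀ v : E N, v ≠ 0 → fderiv ℝ ρ p v = 0 →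
      fderiv ℝ ρ p ((Complex.I : ℂ) • v) = 0 → 0 < levi ρ p v

/-- `η` is the outer unit normal of `Ω` at the boundary point `p`. -/
def IsOuterUnitNormalAt (Ω : Set (E N)) (p η : E N) : Prop :=
  ‖η‖ = 1 ∧ p ∈ frontier Ω ∧ ∃ ε > 0, ∀ t : ℝ, 0 < t → t < ε →
    p - t • η ∈ Ω ∧ bdist Ω (p - t • η) = t

open Classical in
/-- signed boundary distance -/
def signedDist (Ω : Set (E N)) (x : E N) : ℝ :=
  if x ∈ closure Ω then -(bdist Ω x) else bdist Ω x

/-- Hessian quadratic form of the signed boundary distance. -/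
def hessSD (Ω : Set (E N)) (p v : E N) : ℝ :=
  iteratedFDeriv ℝ 2 (signedDist Ω) p ![v, v]

/-- strict linear convexity at `p` (with outer unit normal `η`). -/
def StrictlyLinearlyConvexAt (Ω : Set (E N)) (p η : E N) : Prop :=
  ∀ v : E N, v ≠ 0 → herm v η = 0 → 0 < hessSD Ω p v

/-- strong convexity at `p` (with outer unit normal `η`). -/
def StronglyConvexAt (Ω : Set (E N)) (p η : E N) : Prop :=
  ∀ v : E N, v ≠ 0 → (herm v η).re = 0 → 0 < hessSD Ω p v

/-- `p` is a `C^k`-smooth boundary point of `Ω`. -/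
def IsCkBoundaryPoint (k : ℕ) (Ω : Set (E N)) (p : E N) : Prop :=
  p ∈ frontier Ω ∧ ∃ (U : Set (E N)) (ρ : E N → ℝ), IsOpen U ∧ p ∈ U ∧
    ContDiffOn ℝ k ρ U ∧ (∀ x ∈ U, (x ∈ Ω ↔ ρ x < 0)) ∧
    ∀ x ∈ U ∩ frontier Ω, fderiv ℝ ρ x ≠ 0

/-- bounded domain with `C^k`-smooth boundary. -/
def IsCkDomain (k : ℕ) (Ω : Set (E N)) : Prop :=
  IsOpen Ω ∧ IsConnected Ω ∧ Bornology.IsBounded Ω ∧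
    ∀ p ∈ frontier Ω, IsCkBoundaryPoint k Ω p

/-- bounded domain with `C^{1,1}`-smooth boundary. -/
def IsC11Domain (Ω : Set (E N)) : Prop :=
  IsOpen Ω ∧ IsConnected Ω ∧ Bornology.IsBounded Ω ∧
  ∀ p ∈ frontier Ω, ∃ (U : Set (E N)) (ρ : E N → ℝ), IsOpen U ∧ p ∈ U ∧
    IsCkHolderOn 1 1 ρ U ∧ (∀ x ∈ U, (x ∈ Ω ↔ ρ x < 0)) ∧
    ∀ x ∈ U ∩ frontier Ω, fderiv ℝ ρ x ≠ 0

/-- `p` is a `C^{2,α}`-smooth strongly pseudoconvex boundary point of `Ω`. -/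
def IsSPSCBoundaryPoint (α : ℝ) (Ω : Set (E N)) (p : E N) : Prop :=
  p ∈ frontier Ω ∧ ∃ (U : Set (E N)) (ρ : E N → ℝ), IsOpen U ∧ p ∈ U ∧
    IsCkHolderOn 2 α ρ U ∧ (∀ x ∈ U, (x ∈ Ω ↔ ρ x < 0)) ∧
    (∀ x ∈ U ∩ frontier Ω, fderiv ℝ ρ x ≠ 0) ∧
    ∀ x ∈ U ∩ frontier Ω, ∀ v : E N, v ≠ 0 → fderiv ℝ ρ x v = 0 →
      fderiv ℝ ρ x ((Complex.I : ℂ) • v) = 0 → 0 < levi ρ x v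

instance (N : ℕ) : MeasurableSpace (E N) := borel _

instance (N : ℕ) : BorelSpace (E N) := ⟨rfl⟩

/-- Lebesgue measure on `E N`. -/
def vol (N : ℕ) : Measure (E N) :=
  letI : InnerProductSpace ℝ (E N) := InnerProductSpace.rclikeToReal ℂ (E N)
  letI : MeasureSpace (E N) := measureSpaceOfInnerProductSpace
  volume

/-- Bergman kernel on the diagonal. -/
def bergmanKernelDiag (Ω : Set (E N)) (z : E N) : ℝ :=
  sSup { r : ℝ | ∃ f : E N → ℂ, DifferentiableOn ℂ f Ω ∧
    (∫ x in Ω, ‖f x‖ ^ 2 ∂(vol N)) ≤ 1 ∧ r = ‖f z‖ ^ 2 }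

/-- `M_Ω(z;v)`. -/
def bergmanM (Ω : Set (E N)) (z v : E N) : ℝ :=
  sSup { r : ℝ | ∃ f : E N → ℂ, DifferentiableOn ℂ f Ω ∧
    (∫ x in Ω, ‖f x‖ ^ 2 ∂(vol N)) ≤ 1 ∧ f z = 0 ∧ r = ‖fderiv ℂ f z v‖ }

/-- The Bergman metric. -/
def bergmanMetric (Ω : Set (E N)) (z v : E N) : ℝ :=
  bergmanM Ω z v / Real.sqrt (bergmanKernelDiag Ω z)

/-- The Bergman distance: inner distance of the Bergman metric. -/
def bergmanDist (Ω : Set (E N)) (z w : E N) : ℝ :=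
  sInf { r : ℝ | ∃ γ : ℝ → E N, ContDiffOn ℝ 1 γ (Icc 0 1) ∧ γ 0 = z ∧ γ 1 = w ∧
    (∀ t ∈ Icc (0:ℝ) 1, γ t ∈ Ω) ∧
    r = ∫ t in (0:ℝ)..(1:ℝ), bergmanMetric Ω (γ t) (derivWithin γ (Icc 0 1) t) }


/-- Cauchy's estimate for the Fréchet derivative. -/
lemma norm_fderiv_le_of_norm_le {V W : Type*} [NormedAddCommGroup V] [NormedSpace ℂ V]
    [NormedAddCommGroup W] [NormedSpace ℂ W] {f : V → W} {x : V} {r M : ℝ} (hr : 0 < r)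
    (hd : ∀ y ∈ closedBall x r, DifferentiableAt ℂ f y) (hM : ∀ y ∈ closedBall x r, ‖f y‖ ≤ M) :
    ‖fderiv ℂ f x‖ ≤ M / r := by
  have hM0 : 0 ≤ M := (norm_nonneg _).trans (hM x (mem_closedBall_self hr.le))
  refine ContinuousLinearMap.opNorm_le_bound _ (by positivity) fun v => ?_
  rcases eq_or_ne v 0 with rfl | hv
  · simp
  have hv' : 0 < ‖v‖ := norm_pos_iff.2 hv
  have hmem : ∀ t ∈ closedBall (0 : ℂ) (r / ‖v‖), x + t • v ∈ closedBall x r := by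
    intro t ht
    rw [mem_closedBall_zero_iff, le_div_iff₀ hv'] at ht
    simpa [mem_closedBall_iff_norm, norm_smul] using ht
  have hline : ∀ t : ℂ, HasDerivAt (fun t : ℂ => x + t • v) v t := fun t => by
    simpa using ((hasDerivAt_id t).smul_const v).const_add x
  have hder : ∀ t ∈ closedBall (0 : ℂ) (r / ‖v‖),
      HasDerivAt (fun t : ℂ => f (x + t • v)) (fderiv ℂ f (x + t • v) v) t := fun t ht =>
    (hd _ (hmem t ht)).hasFDerivAt.comp_hasDerivAt t (hline t)
  have h0 := (hder 0 (mem_closedBall_self (by positivity))).deriv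
  have key := Complex.norm_deriv_le_of_forall_mem_sphere_norm_le
    (f := fun t : ℂ => f (x + t • v)) (c := 0) (R := r / ‖v‖) (C := M) (by positivity)
    (DifferentiableOn.diffContOnCl (fun t ht =>
      (hder t (closure_ball_subset_closedBall ht)).differentiableAt.differentiableWithinAt))
    (fun t ht => hM _ (hmem t (sphere_subset_closedBall ht)))
  rw [h0] at key
  simp only [zero_smul, add_zero] at key
  calc _ ≤ _ := key
    _ = _ := by field_simp

/-- A holomorphic map and its derivative are locally Lipschitz. -/
lemma exists_lipschitzOnWith_ball {V W : Type*} [NormedAddCommGroup V] [NormedSpace ℂ V]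
    [NormedAddCommGroup W] [NormedSpace ℂ W] {f : V → W} {U : Set V} (hU : IsOpen U)
    (hf : DifferentiableOn ℂ f U) {x : V} (hx : x ∈ U) :
    ∃ K : NNReal, ∃ r > 0, ball x r ⊆ U ∧ LipschitzOnWith K f (ball x r) ∧
      LipschitzOnWith K (fderiv ℂ f) (ball x r) := by
  have hfat : ∀ y ∈ U, DifferentiableAt ℂ f y := fun y hy => hf.differentiableAt (hU.mem_nhds hy)
  obtain ⟨R, hR, hRU⟩ : ∃ R > 0, ∀ y ∈ ball x R, y ∈ U ∧ ‖f y‖ < ‖f x‖ + 1 :=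
    Metric.eventually_nhds_iff_ball.1 ((hU.eventually_mem hx).and
      ((hfat x hx).continuousAt.norm.eventually_lt_const (lt_add_one _)))
  set M : ℝ := ‖f x‖ + 1
  have hM : 0 < M := by positivity
  have hder : ∀ y ∈ ball x (R / 2), ‖fderiv ℂ f y‖ ≤ M / (R / 4) := fun y hy => by
    have hsub : closedBall y (R / 4) ⊆ ball x R :=
      closedBall_subset_ball' (by rw [mem_ball] at hy; linarith)
    exact norm_fderiv_le_of_norm_le (by positivity) (fun w hw => hfat w (hRU w (hsub hw)).1)
      fun w hw => (hRU w (hsub hw)).2.le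
  have hsub2 : ball x (R / 2) ⊆ U := fun y hy =>
    (hRU y (ball_subset_ball (by linarith) hy)).1
  obtain ⟨K, hK⟩ : ∃ K : NNReal, (K : ℝ) = M / (R / 4) := ⟨⟨_, by positivity⟩, rfl⟩
  have hlip : ∀ y ∈ ball x (R / 2), ∀ w ∈ ball x (R / 2), ‖f y - f w‖ ≤ K * ‖y - w‖ :=
    fun y hy w hw => (convex_ball x (R / 2)).norm_image_sub_le_of_norm_fderiv_le (𝕜 := ℂ)
      (fun u hu => hfat u (hsub2 hu)) (fun u hu => by rw [hK]; exact hder u hu) hw hy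
  obtain ⟨K', hK'⟩ : ∃ K' : NNReal, (K' : ℝ) = K / (R / 8) := ⟨⟨_, by positivity⟩, rfl⟩
  refine ⟨max K K', R / 8, by positivity, (ball_subset_ball (by linarith)).trans hsub2, ?_, ?_⟩
  · refine (LipschitzOnWith.of_dist_le_mul fun y hy w hw => ?_).weaken (le_max_left K K')
    rw [dist_eq_norm, dist_eq_norm]
    exact hlip y (ball_subset_ball (by linarith) hy) w (ball_subset_ball (by linarith) hw)
  · refine (LipschitzOnWith.of_dist_le_mul fun y hy w hw => ?_).weaken (le_max_right K K')
    rw [dist_eq_norm, dist_eq_norm]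
    have hmem : ∀ u ∈ ball x (R / 8), ∀ t ∈ closedBall (0 : V) (R / 8),
        u + t ∈ ball x (R / 2) := by
      intro u hu t ht
      rw [mem_ball_iff_norm] at hu ⊢
      rw [mem_closedBall_zero_iff] at ht
      calc ‖u + t - x‖ = ‖(u - x) + t‖ := by congr 1; abel
        _ ≤ ‖u - x‖ + ‖t‖ := norm_add_le _ _
        _ < R / 2 := by linarith
    have hshift : ∀ u ∈ ball x (R / 8), ∀ t ∈ closedBall (0 : V) (R / 8),
        HasFDerivAt (fun t => f (u + t)) (fderiv ℂ f (u + t)) t := fun u hu t ht =>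
      (hasFDerivAt_comp_add_left u).2 (hfat _ (hsub2 (hmem u hu t ht))).hasFDerivAt
    have hdiff : ∀ t ∈ closedBall (0 : V) (R / 8),
        HasFDerivAt (fun t => f (y + t) - f (w + t)) (fderiv ℂ f (y + t) - fderiv ℂ f (w + t)) t :=
      fun t ht => (hshift y hy t ht).sub (hshift w hw t ht)
    have key := norm_fderiv_le_of_norm_le (f := fun t => f (y + t) - f (w + t)) (x := 0)
      (M := K * ‖y - w‖) (show 0 < R / 8 by positivity)
      (fun t ht => (hdiff t ht).differentiableAt)
      (fun t ht => by simpa using hlip _ (hmem y hy t ht) _ (hmem w hw t ht))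
    rw [(hdiff 0 (mem_closedBall_self (by positivity))).fderiv] at key
    simp only [add_zero] at key
    calc _ ≤ _ := key
      _ = _ := by rw [hK']; ring

lemma herm_eq_inner (a b : E N) : herm a b = inner ℂ b a := by
  simp [herm, PiLp.inner_apply]

lemma norm_add_smul_sq (m v : E N) (t : ℝ) :
    ‖m + t • v‖ ^ 2 = ‖m‖ ^ 2 + t * (2 * (herm v m).re + t * ‖v‖ ^ 2) := by
  have h := norm_add_sq (𝕜 := ℂ) m (t • v)
  rw [h, herm_eq_inner, norm_smul, mul_pow, Real.norm_eq_abs, sq_abs,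
    ← Complex.coe_smul, inner_smul_right]
  simp
  ring

/-- The complex linear functional whose real part is `ℓ`. -/
def complexify (ℓ : E N →L[ℝ] ℝ) (v : E N) : ℂ := ℓ v - Complex.I * ℓ (Complex.I • v)

lemma complexify_sub (ℓ : E N →L[ℝ] ℝ) (v w : E N) :
    complexify ℓ (v - w) = complexify ℓ v - complexify ℓ w := by
  simp only [complexify, smul_sub, map_sub, Complex.ofReal_sub]; ring

lemma complexify_sub_left (ℓ ℓ' : E N →L[ℝ] ℝ) (v : E N) :
    complexify (ℓ - ℓ') v = complexify ℓ v - complexify ℓ' v := by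
  simp only [complexify, sub_apply, Complex.ofReal_sub]; ring

lemma norm_complexify_le (ℓ : E N →L[ℝ] ℝ) (v : E N) : ‖complexify ℓ v‖ ≤ 2 * ‖ℓ‖ * ‖v‖ := by
  have h1 := ℓ.le_opNorm v
  have h2 := ℓ.le_opNorm (Complex.I • v)
  rw [norm_smul, Complex.norm_I, one_mul] at h2
  calc ‖complexify ℓ v‖ ≤ ‖(ℓ v : ℂ)‖ + ‖Complex.I * (ℓ (Complex.I • v) : ℂ)‖ := norm_sub_le _ _
    _ = ‖ℓ v‖ + ‖ℓ (Complex.I • v)‖ := by simp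
    _ ≤ _ := by linarith

lemma mul_norm_sq_eq_of_nonpos {m : E N} {ℓ : E N →L[ℝ] ℝ}
    (h : ∀ v, (herm v m).re < 0 → ℓ v ≤ 0) (v : E N) :
    ℓ v * ‖m‖ ^ 2 = ℓ m * (herm v m).re := by
  rcases eq_or_ne m 0 with rfl | hm
  · simp
  have hm' : 0 < ‖m‖ ^ 2 := by positivity
  have hmm : (herm m m).re = ‖m‖ ^ 2 := by
    rw [herm_eq_inner, inner_self_eq_norm_sq_to_K]; norm_cast
  have hlin : ∀ (a b : ℝ) (x y : E N),
      (herm (a • x + b • y) m).re = a * (herm x m).re + b * (herm y m).re := by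
    intro a b x y
    simp only [herm_eq_inner, inner_add_right, ← Complex.coe_smul, inner_smul_right]
    simp
  have hker : ∀ w, (herm w m).re = 0 → ℓ w ≤ 0 := by
    intro w hw
    by_contra! hpos
    have hε : 0 < ℓ w / (2 * (|ℓ m| + 1)) := by positivity
    set ε := ℓ w / (2 * (|ℓ m| + 1)) with hεd
    have h1 := h ((1 : ℝ) • w + (-ε) • m) (by rw [hlin, hw, hmm]; nlinarith)
    rw [map_add, map_smul, map_smul, smul_eq_mul, smul_eq_mul] at h1
    have h2 : ε * (2 * (|ℓ m| + 1)) = ℓ w := by rw [hεd]; field_simp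
    nlinarith [le_abs_self (ℓ m), abs_nonneg (ℓ m)]
  have h1 := hker (‖m‖ ^ 2 • v + (-(herm v m).re) • m) (by rw [hlin, hmm]; ring)
  have h2 := hker ((-‖m‖ ^ 2) • v + (herm v m).re • m) (by rw [hlin, hmm]; ring)
  simp only [map_add, map_smul, smul_eq_mul] at h1 h2
  linarith

lemma complexify_mul_norm_sq {m : E N} {ℓ : E N →L[ℝ] ℝ}
    (h : ∀ v, (herm v m).re < 0 → ℓ v ≤ 0) (v : E N) :
    complexify ℓ v * (‖m‖ ^ 2 : ℝ) = ℓ m * herm v m := by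
  have h1 := mul_norm_sq_eq_of_nonpos h v
  have h2 := mul_norm_sq_eq_of_nonpos h (Complex.I • v)
  have h3 : (herm (Complex.I • v) m).re = -(herm v m).im := by
    simp [herm_eq_inner]
  rw [h3] at h2
  apply Complex.ext <;> simp [complexify, -Complex.ofReal_pow] <;> linarith

lemma norm_complexify_le_of_nonpos {m : E N} (hm : m ≠ 0) {ℓ : E N →L[ℝ] ℝ}
    (h : ∀ v, (herm v m).re < 0 → ℓ v ≤ 0) (v : E N) :
    ‖complexify ℓ v‖ ≤ ‖ℓ‖ * (‖herm v m‖ / ‖m‖) := by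
  have hm' : 0 < ‖m‖ := norm_pos_iff.2 hm
  have h1 := congrArg norm (complexify_mul_norm_sq h v)
  rw [norm_mul, norm_mul, Complex.norm_real, Complex.norm_real, norm_pow, norm_norm] at h1
  rw [← mul_div_assoc, le_div_iff₀ hm']
  refine le_of_mul_le_mul_right ?_ hm'
  calc ‖complexify ℓ v‖ * ‖m‖ * ‖m‖ = ‖ℓ m‖ * ‖herm v m‖ := by rw [← h1]; ring
    _ ≤ (‖ℓ‖ * ‖m‖) * ‖herm v m‖ := by gcongr; exact ℓ.le_opNorm m
    _ = _ := by ring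

lemma apply_mul_le_of_nonpos {m : E N} (hm : m ≠ 0) {ℓ : E N →L[ℝ] ℝ}
    (h : ∀ v, (herm v m).re < 0 → ℓ v ≤ 0) (a v : E N) :
    ℓ a * (‖herm v m‖ / ‖m‖) ≤ ‖a‖ * ‖complexify ℓ v‖ := by
  have hm' : 0 < ‖m‖ := norm_pos_iff.2 hm
  have h1 := congrArg norm (complexify_mul_norm_sq h v)
  rw [norm_mul, norm_mul, Complex.norm_real, Complex.norm_real, norm_pow, norm_norm] at h1
  have h2 : ℓ a * ‖m‖ ≤ ‖ℓ m‖ * ‖a‖ := by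
    refine le_of_mul_le_mul_right ?_ hm'
    have hre : |(herm a m).re| ≤ ‖m‖ * ‖a‖ := (Complex.abs_re_le_norm _).trans
      (by rw [herm_eq_inner]; exact norm_inner_le_norm _ _)
    calc ℓ a * ‖m‖ * ‖m‖ = ℓ m * (herm a m).re := by
          rw [← mul_norm_sq_eq_of_nonpos h a]; ring
      _ ≤ |ℓ m| * |(herm a m).re| := by rw [← abs_mul]; exact le_abs_self _
      _ ≤ ‖ℓ m‖ * (‖m‖ * ‖a‖) := by rw [Real.norm_eq_abs]; gcongr
      _ = _ := by ring
  rw [← mul_div_assoc, div_le_iff₀ hm']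
  refine le_of_mul_le_mul_right ?_ hm'
  calc ℓ a * ‖herm v m‖ * ‖m‖ = (ℓ a * ‖m‖) * ‖herm v m‖ := by ring
    _ ≤ (‖ℓ m‖ * ‖a‖) * ‖herm v m‖ := by gcongr
    _ = (‖ℓ m‖ * ‖herm v m‖) * ‖a‖ := by ring
    _ = _ := by rw [← h1]; ring

lemma ball_bdist_subset {Ω : Set (E N)} (hΩ : IsOpen Ω) {z : E N} (hz : z ∈ Ω) :
    ball z (bdist Ω z) ⊆ Ω := by
  rcases le_or_gt (bdist Ω z) 0 with h0 | h0
  · simp [ball_eq_empty.2 h0]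
  refine (convex_ball z (bdist Ω z)).isPreconnected.subset_left_of_subset_union hΩ
    isClosed_closure.isOpen_compl (disjoint_compl_right.mono_left subset_closure) ?_
    ⟨z, mem_ball_self h0, hz⟩
  intro x hx
  by_contra hcon
  simp only [mem_union, mem_compl_iff, not_or, not_not] at hcon
  have hfr : x ∈ frontier Ω := by rw [hΩ.frontier_eq]; exact ⟨hcon.2, hcon.1⟩
  have := infDist_le_dist_of_mem (x := z) hfr
  rw [mem_ball, dist_comm] at hx
  exact absurd hx (not_lt.2 this)

lemma IsClosestPointSelection.sub_ne_zero {Ω : Set (E N)} {π : E N → E N} (hΩ : IsOpen Ω)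
    (hπ : IsClosestPointSelection Ω π) {z : E N} (hz : z ∈ Ω) : π z - z ≠ 0 := by
  intro h
  have h1 := (hπ z hz).1
  rw [sub_eq_zero.1 h, hΩ.frontier_eq] at h1
  exact h1.2 hz

lemma IsClosestPointSelection.bdist_eq {Ω : Set (E N)} {π : E N → E N}
    (hπ : IsClosestPointSelection Ω π) {z : E N} (hz : z ∈ Ω) : bdist Ω z = ‖π z - z‖ := by
  rw [← (hπ z hz).2, dist_comm, dist_eq_norm]

lemma IsClosestPointSelection.bdist_pos {Ω : Set (E N)} {π : E N → E N} (hΩ : IsOpen Ω)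
    (hπ : IsClosestPointSelection Ω π) {z : E N} (hz : z ∈ Ω) : 0 < bdist Ω z := by
  rw [hπ.bdist_eq hz]
  exact norm_pos_iff.2 (hπ.sub_ne_zero hΩ hz)

lemma IsClosestPointSelection.ncomp_le {Ω : Set (E N)} {π : E N → E N} (hΩ : IsOpen Ω)
    (hπ : IsClosestPointSelection Ω π) {z : E N} (hz : z ∈ Ω) (v : E N) :
    ncomp Ω π z v ≤ ‖v‖ := by
  rw [ncomp, hπ.bdist_eq hz, div_le_iff₀ (norm_pos_iff.2 (hπ.sub_ne_zero hΩ hz)), herm_eq_inner,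
    mul_comm]
  exact norm_inner_le_norm _ _

/-- At a closest boundary point, the derivative of a local defining function is nonpositive in the
inward directions. -/
lemma IsClosestPointSelection.fderiv_nonpos {Ω V : Set (E N)} {π : E N → E N} (hΩ : IsOpen Ω)
    (hπ : IsClosestPointSelection Ω π) {z : E N} (hz : z ∈ Ω) (hV : IsOpen V) (hzV : π z ∈ V)
    {ψ : E N → ℝ} (hψ : ContinuousOn ψ V) (hiff : ∀ x ∈ V, x ∈ Ω ↔ ψ x < 0)
    {ψ' : E N →L[ℝ] ℝ} (hd : HasFDerivAt ψ ψ' (π z)) {v : E N}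
    (hv : (herm v (π z - z)).re < 0) : ψ' v ≤ 0 := by
  set q := π z
  have hδ : 0 < bdist Ω z := hπ.bdist_pos hΩ hz
  have hqΩ : q ∉ Ω := fun h => by
    have := (hπ z hz).1
    rw [hΩ.frontier_eq] at this
    exact this.2 h
  have hq0 : 0 ≤ ψ q := not_lt.1 fun h => hqΩ ((hiff q hzV).2 h)
  have hcl : closedBall z (bdist Ω z) ⊆ closure Ω := by
    rw [← closure_ball z hδ.ne']
    exact closure_mono (ball_bdist_subset hΩ hz)
  have hle : ∀ x ∈ V ∩ closure Ω, ψ x ≤ 0 := by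
    rintro x ⟨hxV, hx⟩
    by_contra! hpos
    have hev : ∀ᶠ y in 𝓝 x, y ∈ V ∧ 0 < ψ y := (hV.eventually_mem hxV).and
      ((hψ.continuousAt (hV.mem_nhds hxV)).eventually_const_lt hpos)
    obtain ⟨y, hyΩ, hyV, hy⟩ := ((mem_closure_iff_frequently.1 hx).and_eventually hev).exists
    exact absurd ((hiff y hyV).1 hyΩ) (not_lt.2 hy.le)
  have hmax : IsLocalMaxOn ψ (closedBall z (bdist Ω z)) q := by
    filter_upwards [self_mem_nhdsWithin, mem_nhdsWithin_of_mem_nhds (hV.mem_nhds hzV)] with x hx hxV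
    exact (hle x ⟨hxV, hcl hx⟩).trans hq0
  have hv0 : 0 < ‖v‖ ^ 2 := by
    have : v ≠ 0 := by rintro rfl; simp [herm] at hv
    positivity
  set t : ℝ := -(2 * (herm v (q - z)).re) / ‖v‖ ^ 2 with ht
  have ht0 : 0 < t := div_pos (by linarith) hv0
  have hmem : q + t • v ∈ closedBall z (bdist Ω z) := by
    have h1 := norm_add_smul_sq (q - z) v t
    have h2 : t * ‖v‖ ^ 2 = -(2 * (herm v (q - z)).re) := div_mul_cancel₀ _ hv0.ne'
    rw [h2, add_neg_cancel, mul_zero, add_zero] at h1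
    rw [mem_closedBall_iff_norm, hπ.bdist_eq hz]
    have h3 : q + t • v - z = q - z + t • v := by abel
    rw [h3]
    exact ((pow_left_inj₀ (norm_nonneg _) (norm_nonneg _) two_ne_zero).1 h1).le
  have hqmem : q ∈ closedBall z (bdist Ω z) := by
    rw [mem_closedBall, dist_comm]; exact (hπ z hz).2.le
  have key := hmax.hasFDerivWithinAt_nonpos hd.hasFDerivWithinAt
    (sub_mem_posTangentConeAt_of_segment_subset ((convex_closedBall _ _).segment_subset hqmem hmem))
  rw [add_sub_cancel_left, map_smul, smul_eq_mul] at key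
  exact nonpos_of_mul_nonpos_right key ht0

lemma IsClosestPointSelection.tendsto {Ω : Set (E N)} {π : E N → E N}
    (hπ : IsClosestPointSelection Ω π) {p : E N} (hp : p ∈ frontier Ω) :
    Tendsto π (𝓝[Ω] p) (𝓝 p) := by
  rw [tendsto_iff_dist_tendsto_zero]
  have h0 : Tendsto (fun z => 2 * dist z p) (𝓝[Ω] p) (𝓝 0) := by
    have : ContinuousAt (fun z => 2 * dist z p) p := by fun_prop
    simpa using this.tendsto.mono_left nhdsWithin_le_nhds
  refine squeeze_zero' (Eventually.of_forall fun _ => dist_nonneg) ?_ h0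
  filter_upwards [self_mem_nhdsWithin] with z hz
  have h1 : dist z (π z) ≤ dist z p := (hπ z hz).2.trans_le (infDist_le_dist_of_mem hp)
  linarith [dist_triangle_left (π z) p z]

/-- A biholomorphism `f` of `Ω₁` onto `Ω₂` extending to a biholomorphism (with inverse `g`) between
neighbourhoods `U₁`, `U₂` of the closures. -/
structure IsBiholomorphicPair (Ω₁ Ω₂ U₁ U₂ : Set (E N)) (f g : E N → E N) : Prop where
  isOpen_left : IsOpen U₁
  isOpen_right : IsOpen U₂
  closure_left : closure Ω₁ ⊆ U₁
  closure_right : closure Ω₂ ⊆ U₂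
  differentiableOn : DifferentiableOn ℂ f U₁
  differentiableOn_inv : DifferentiableOn ℂ g U₂
  mapsTo : MapsTo f U₁ U₂
  mapsTo_inv : MapsTo g U₂ U₁
  left_inv : ∀ x ∈ U₁, g (f x) = x
  right_inv : ∀ y ∈ U₂, f (g y) = y
  image_eq : f '' Ω₁ = Ω₂

namespace IsBiholomorphicPair

variable {Ω₁ Ω₂ U₁ U₂ : Set (E N)} {f g : E N → E N}

lemma symm (h : IsBiholomorphicPair Ω₁ Ω₂ U₁ U₂ f g) : IsBiholomorphicPair Ω₂ Ω₁ U₂ U₁ g f where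
  isOpen_left := h.isOpen_right
  isOpen_right := h.isOpen_left
  closure_left := h.closure_right
  closure_right := h.closure_left
  differentiableOn := h.differentiableOn_inv
  differentiableOn_inv := h.differentiableOn
  mapsTo := h.mapsTo_inv
  mapsTo_inv := h.mapsTo
  left_inv := h.right_inv
  right_inv := h.left_inv
  image_eq := by
    rw [← h.image_eq, image_image]
    exact (image_congr fun x hx => h.left_inv x (h.closure_left (subset_closure hx))).trans
      (image_id' _)

lemma mem_right (h : IsBiholomorphicPair Ω₁ Ω₂ U₁ U₂ f g) {z : E N} (hz : z ∈ Ω₁) : f z ∈ Ω₂ :=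
  h.image_eq ▸ mem_image_of_mem f hz

lemma mem_iff (h : IsBiholomorphicPair Ω₁ Ω₂ U₁ U₂ f g) {z : E N} (hz : z ∈ U₁) :
    f z ∈ Ω₂ ↔ z ∈ Ω₁ :=
  ⟨fun hfz => by simpa only [h.left_inv z hz] using h.symm.mem_right hfz, h.mem_right⟩

lemma continuousAt (h : IsBiholomorphicPair Ω₁ Ω₂ U₁ U₂ f g) {z : E N} (hz : z ∈ U₁) :
    ContinuousAt f z :=
  h.differentiableOn.continuousOn.continuousAt (h.isOpen_left.mem_nhds hz)

lemma hasFDerivAt (h : IsBiholomorphicPair Ω₁ Ω₂ U₁ U₂ f g) {z : E N} (hz : z ∈ U₁) :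
    HasFDerivAt f (fderiv ℂ f z) z :=
  (h.differentiableOn.differentiableAt (h.isOpen_left.mem_nhds hz)).hasFDerivAt

lemma fderiv_inv_apply (h : IsBiholomorphicPair Ω₁ Ω₂ U₁ U₂ f g) {z : E N} (hz : z ∈ U₁)
    (v : E N) : fderiv ℂ g (f z) (fderiv ℂ f z v) = v := by
  have h1 := (h.symm.hasFDerivAt (h.mapsTo hz)).comp z (h.hasFDerivAt hz)
  have h2 : HasFDerivAt (g ∘ f) (ContinuousLinearMap.id ℂ (E N)) z :=
    (hasFDerivAt_id z).congr_of_eventuallyEq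
      (by filter_upwards [h.isOpen_left.mem_nhds hz] with x hx using h.left_inv x hx)
  exact DFunLike.congr_fun (h1.unique h2) v

lemma mem_frontier (h : IsBiholomorphicPair Ω₁ Ω₂ U₁ U₂ f g) (hΩ₁ : IsOpen Ω₁) (hΩ₂ : IsOpen Ω₂)
    {p : E N} (hp : p ∈ frontier Ω₁) : f p ∈ frontier Ω₂ := by
  rw [hΩ₁.frontier_eq] at hp
  have hpU := h.closure_left hp.1
  rw [hΩ₂.frontier_eq]
  refine ⟨?_, fun hfp => hp.2 ((h.mem_iff hpU).1 hfp)⟩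
  rw [← h.image_eq]
  exact mem_closure_image (h.continuousAt hpU) hp.1

lemma exists_lipschitzOnWith_closure (h : IsBiholomorphicPair Ω₁ Ω₂ U₁ U₂ f g)
    (hb : Bornology.IsBounded Ω₁) : ∃ L, LipschitzOnWith L f (closure Ω₁) := by
  refine LocallyLipschitzOn.exists_lipschitzOnWith_of_compact hb.isCompact_closure fun x hx => ?_
  obtain ⟨K, r, hr, -, hK, -⟩ :=
    exists_lipschitzOnWith_ball h.isOpen_left h.differentiableOn (h.closure_left hx)
  exact ⟨K, ball x r, mem_nhdsWithin_of_mem_nhds (ball_mem_nhds x hr), hK⟩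

lemma bdist_le (h : IsBiholomorphicPair Ω₁ Ω₂ U₁ U₂ f g) (hΩ₁ : IsOpen Ω₁) (hΩ₂ : IsOpen Ω₂)
    {π : E N → E N} (hπ : IsClosestPointSelection Ω₁ π) {L : NNReal}
    (hL : LipschitzOnWith L f (closure Ω₁)) {z : E N} (hz : z ∈ Ω₁) :
    bdist Ω₂ (f z) ≤ L * bdist Ω₁ z := by
  obtain ⟨hp, hd⟩ := hπ z hz
  rw [← hd]
  exact (infDist_le_dist_of_mem (h.mem_frontier hΩ₁ hΩ₂ hp)).trans
    (hL.dist_le_mul _ (subset_closure hz) _ (frontier_subset_closure hp))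

end IsBiholomorphicPair

/-- The quantity `‖(z-w)_z‖ + ‖z-w‖² + δ(z)^{1/2}‖z-w‖`. -/
def normalGauge (Ω : Set (E N)) (π : E N → E N) (z w : E N) : ℝ :=
  ncomp Ω π z (z - w) + ‖z - w‖ ^ 2 + Real.sqrt (bdist Ω z) * ‖z - w‖

lemma ncomp_nonneg (Ω : Set (E N)) (π : E N → E N) (z v : E N) : 0 ≤ ncomp Ω π z v :=
  div_nonneg (norm_nonneg _) infDist_nonneg

lemma normalGauge_nonneg (Ω : Set (E N)) (π : E N → E N) (z w : E N) :
    0 ≤ normalGauge Ω π z w := by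
  have := ncomp_nonneg Ω π z (z - w)
  unfold normalGauge
  positivity

/-- Second order Taylor estimate based at a nearby point `q`. -/
lemma norm_sub_sub_fderiv_le {V W : Type*} [NormedAddCommGroup V] [NormedSpace ℂ V]
    [NormedAddCommGroup W] [NormedSpace ℂ W] {g : V → W} {T : Set V} (hT : Convex ℝ T)
    (hd : ∀ x ∈ T, DifferentiableAt ℂ g x) {K : NNReal} (hK : LipschitzOnWith K (fderiv ℂ g) T)
    {x y q : V} (hx : x ∈ T) (hy : y ∈ T) (hq : q ∈ T) :
    ‖g x - g y - fderiv ℂ g q (x - y)‖ ≤ K * (dist x q + ‖x - y‖) * ‖x - y‖ := by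
  refine (hT.inter (convex_closedBall x ‖x - y‖)).norm_image_sub_le_of_norm_fderiv_le' (𝕜 := ℂ)
    (fun u hu => hd u hu.1) (fun u hu => ?_) ⟨hy, ?_⟩ ⟨hx, mem_closedBall_self (norm_nonneg _)⟩
  · rw [← dist_eq_norm]
    refine (hK.dist_le_mul u hu.1 q hq).trans ?_
    gcongr
    linarith [dist_triangle u x q, mem_closedBall.1 hu.2]
  · rw [mem_closedBall, dist_comm, dist_eq_norm]

lemma exists_ncomp_le_of_mem_frontier {Ω₁ Ω₂ U₁ U₂ : Set (E N)} {f g : E N → E N}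
    (h : IsBiholomorphicPair Ω₁ Ω₂ U₁ U₂ f g) (hΩ₁ : IsOpen Ω₁) (hΩ₂ : IsOpen Ω₂)
    {π₁ π₂ : E N → E N} (hπ₁ : IsClosestPointSelection Ω₁ π₁)
    (hπ₂ : IsClosestPointSelection Ω₂ π₂) {L : NNReal} (hL : LipschitzOnWith L f (closure Ω₁))
    {p : E N} (hp : IsCkBoundaryPoint 2 Ω₁ p) :
    ∃ C : ℝ, ∀ᶠ x : E N × E N in 𝓝[Ω₁ ×ˢ Ω₁] (p, p),
      ncomp Ω₂ π₂ (f x.1) (f x.1 - f x.2) ≤ C * normalGauge Ω₁ π₁ x.1 x.2 := by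
  obtain ⟨hpf, U, ρ, hU, hpU, hρ, hiff, hne⟩ := hp
  have hpU₁ : p ∈ U₁ := h.closure_left (frontier_subset_closure hpf)
  have hqf : f p ∈ frontier Ω₂ := h.mem_frontier hΩ₁ hΩ₂ hpf
  have hqU₂ : f p ∈ U₂ := h.mapsTo hpU₁
  have hgfp : g (f p) = p := h.left_inv p hpU₁
  have hgc : ContinuousAt g (f p) := h.symm.continuousAt hqU₂
  have hgt : Tendsto g (𝓝 (f p)) (𝓝 p) := by simpa only [ContinuousAt, hgfp] using hgc
  -- local bounds for the defining function and the inverse map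
  have hρ' : ContDiffAt ℝ 1 (fderiv ℝ ρ) p :=
    (hρ.contDiffAt (hU.mem_nhds hpU)).fderiv_right (m := 1) (by norm_num)
  obtain ⟨K₁, S, hS, hK₁⟩ := hρ'.exists_lipschitzOnWith
  obtain ⟨K₂, r, hr, hrU, hK₂, hK₂'⟩ :=
    exists_lipschitzOnWith_ball h.isOpen_right h.differentiableOn_inv hqU₂
  set M : ℝ := ‖fderiv ℝ ρ p‖ + 1
  have hM : 0 ≤ M := by positivity
  have hMev : ∀ᶠ x in 𝓝 p, ‖fderiv ℝ ρ x‖ < M :=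
    hρ'.continuousAt.norm.eventually_lt_const (lt_add_one _)
  -- a transversal direction
  obtain ⟨u, hu⟩ : ∃ u, 0 < fderiv ℝ ρ p u := by
    by_contra! hcon
    refine hne p ⟨hpU, hpf⟩ (ContinuousLinearMap.ext fun u => le_antisymm (hcon u) ?_)
    simpa using hcon (-u)
  obtain ⟨a, c, hc, hcev⟩ : ∃ a : E N, ∃ c > 0,
      ∀ᶠ q in 𝓝 (f p), c < fderiv ℝ ρ (g q) (fderiv ℂ g q a) := by
    refine ⟨fderiv ℂ f p u, fderiv ℝ ρ p u / 2, by positivity, ?_⟩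
    have h1 : ContinuousAt (fun q => fderiv ℝ ρ (g q)) (f p) :=
      ContinuousAt.comp (by rw [hgfp]; exact hρ'.continuousAt) hgc
    have h2 : ContinuousAt (fderiv ℂ g) (f p) :=
      hK₂'.continuousOn.continuousAt (ball_mem_nhds _ hr)
    have h3 := h1.clm_apply (h2.clm_apply (continuousAt_const (y := fderiv ℂ f p u)))
    refine h3.eventually_const_lt ?_
    beta_reduce
    rw [h.fderiv_inv_apply hpU₁, hgfp]
    linarith
  -- eventual properties of the points involved
  have hft : Tendsto f (𝓝[Ω₁] p) (𝓝[Ω₂] (f p)) :=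
    tendsto_nhdsWithin_iff.2 ⟨(h.continuousAt hpU₁).tendsto.mono_left nhdsWithin_le_nhds,
      eventually_mem_nhdsWithin.mono fun z hz => h.mem_right hz⟩
  have hfT : ∀ᶠ z in 𝓝[Ω₁] p, f z ∈ ball (f p) r :=
    (hft.mono_right nhdsWithin_le_nhds).eventually (ball_mem_nhds _ hr)
  have hpev := (hπ₁.tendsto hpf).eventually
    ((show ∀ᶠ x in 𝓝 p, x ∈ S from hS).and ((hU.eventually_mem hpU).and hMev))
  have hqev := ((hπ₂.tendsto hqf).comp hft).eventually
    ((isOpen_ball.eventually_mem (mem_ball_self hr)).and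
      ((hgt.eventually
        ((show ∀ᶠ x in 𝓝 p, x ∈ S from hS).and ((hU.eventually_mem hpU).and hMev))).and hcev))
  have hδev : ∀ᶠ z in 𝓝[Ω₁] p, bdist Ω₁ z ≤ 1 := by
    filter_upwards [mem_nhdsWithin_of_mem_nhds (ball_mem_nhds p one_pos)] with z hz
    exact (infDist_le_dist_of_mem hpf).trans (mem_ball.1 hz).le
  set B₁ : ℝ := 2 * K₁ * (K₂ * L + 1)
  set B₂ : ℝ := 2 * M * K₂ * L ^ 2
  refine ⟨‖a‖ * (M + B₁ + B₂) / c, ?_⟩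
  rw [nhdsWithin_prod_eq]
  filter_upwards [(((eventually_mem_nhdsWithin.and hfT).and (hpev.and hqev)).and hδev).prod_mk
    (eventually_mem_nhdsWithin.and hfT)]
  rintro ⟨z, w⟩ ⟨⟨⟨⟨hz, hfz⟩, ⟨hpS, hpU', hpM⟩, hqT, ⟨hqS, hqU, hqM⟩, hqc⟩, hδ1⟩, hw, hfw⟩
  simp only [Function.comp_apply] at *
  have hzU := h.closure_left (subset_closure hz)
  have hwU := h.closure_left (subset_closure hw)
  have hfz2 := h.mem_right hz
  set δ := bdist Ω₁ z with hδ
  have hδ0 : 0 ≤ δ := infDist_nonneg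
  have hδ' : dist (f z) (π₂ (f z)) ≤ L * δ :=
    (hπ₂ _ hfz2).2.trans_le (h.bdist_le hΩ₁ hΩ₂ hπ₁ hL hz)
  set q := π₂ (f z) with hq
  have hv : ‖f z - f w‖ ≤ L * ‖z - w‖ := by
    simpa only [dist_eq_norm] using
      hL.dist_le_mul z (subset_closure hz) w (subset_closure hw)
  set v := f z - f w
  -- the derivative of the transported defining function
  have hqd := ((hρ.differentiableOn (by norm_num)).differentiableAt
    (hU.mem_nhds hqU)).hasFDerivAt.comp q ((h.symm.hasFDerivAt (hrU hqT)).restrictScalars ℝ)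
  have hVo : IsOpen (U₂ ∩ g ⁻¹' U) :=
    h.differentiableOn_inv.continuousOn.isOpen_inter_preimage h.isOpen_right hU
  have hn₂ : ∀ x, (herm x (q - f z)).re < 0 → _ := fun x hx =>
    hπ₂.fderiv_nonpos hΩ₂ hfz2 hVo ⟨hrU hqT, hqU⟩
      (hρ.continuousOn.comp (h.differentiableOn_inv.continuousOn.mono inter_subset_left)
        fun y hy => hy.2)
      (fun y hy => (h.symm.mem_iff hy.1).symm.trans (hiff _ hy.2)) hqd hx
  have hn₁ : ∀ x, (herm x (π₁ z - z)).re < 0 → _ := fun x hx =>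
    hπ₁.fderiv_nonpos hΩ₁ hz hU hpU' hρ.continuousOn hiff
      ((hρ.differentiableOn (by norm_num)).differentiableAt (hU.mem_nhds hpU')).hasFDerivAt hx
  have e₁ := norm_complexify_le_of_nonpos (hπ₁.sub_ne_zero hΩ₁ hz) hn₁ (z - w)
  have e₂ := apply_mul_le_of_nonpos (hπ₂.sub_ne_zero hΩ₂ hfz2) hn₂ a v
  rw [← hπ₁.bdist_eq hz] at e₁
  rw [← hπ₂.bdist_eq hfz2] at e₂
  change _ ≤ _ * ncomp Ω₁ π₁ z (z - w) at e₁
  change fderiv ℝ ρ (g q) (fderiv ℂ g q a) * ncomp Ω₂ π₂ (f z) v ≤ _ at e₂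
  have e₃ : complexify ((fderiv ℝ ρ (g q)).comp ((fderiv ℂ g q).restrictScalars ℝ)) v =
      complexify (fderiv ℝ ρ (g q)) (fderiv ℂ g q v) := by
    simp [complexify]
  rw [e₃] at e₂
  have t₁ : ‖(z - w) - fderiv ℂ g q v‖ ≤ K₂ * (L * δ + L * ‖z - w‖) * (L * ‖z - w‖) := by
    have := norm_sub_sub_fderiv_le (convex_ball (f p) r)
      (fun x hx => (h.symm.hasFDerivAt (hrU hx)).differentiableAt) hK₂' hfz hfw hqT
    rw [h.left_inv z hzU, h.left_inv w hwU] at this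
    refine this.trans ?_
    gcongr
  have t₂ : ‖complexify (fderiv ℝ ρ (g q)) (z - w) -
      complexify (fderiv ℝ ρ (g q)) (fderiv ℂ g q v)‖ ≤
      2 * M * (K₂ * (L * δ + L * ‖z - w‖) * (L * ‖z - w‖)) := by
    rw [← complexify_sub]
    refine (norm_complexify_le _ _).trans ?_
    gcongr
  have t₃ : ‖complexify (fderiv ℝ ρ (g q)) (z - w) - complexify (fderiv ℝ ρ (π₁ z)) (z - w)‖ ≤
      2 * (K₁ * (K₂ * (L * δ) + δ)) * ‖z - w‖ := by
    rw [← complexify_sub_left]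
    refine (norm_complexify_le _ _).trans ?_
    have h1 := hK₁.dist_le_mul _ hqS _ hpS
    have h2 := hK₂.dist_le_mul _ hqT _ hfz
    rw [h.left_inv z hzU, dist_comm q] at h2
    rw [dist_eq_norm] at h1
    have h3 : dist (g q) (π₁ z) ≤ K₂ * (L * δ) + δ := by
      refine (dist_triangle _ z _).trans (add_le_add (h2.trans ?_) (hπ₁ z hz).2.le)
      gcongr
    gcongr
    exact h1.trans (by gcongr)
  have hsq : δ ≤ √δ := Real.le_sqrt_of_sq_le (by nlinarith)
  have hn0 := ncomp_nonneg Ω₁ π₁ z (z - w)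
  have hD : ‖complexify (fderiv ℝ ρ (g q)) (fderiv ℂ g q v)‖ ≤
      M * ncomp Ω₁ π₁ z (z - w) + B₁ * (δ * ‖z - w‖) + B₂ * (δ * ‖z - w‖ + ‖z - w‖ ^ 2) := by
    have h4 : ‖fderiv ℝ ρ (π₁ z)‖ * ncomp Ω₁ π₁ z (z - w) ≤ M * ncomp Ω₁ π₁ z (z - w) := by
      gcongr
    have h5 := norm_sub_norm_le (complexify (fderiv ℝ ρ (g q)) (fderiv ℂ g q v))
      (complexify (fderiv ℝ ρ (g q)) (z - w))
    have h6 := norm_sub_norm_le (complexify (fderiv ℝ ρ (g q)) (z - w))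
      (complexify (fderiv ℝ ρ (π₁ z)) (z - w))
    rw [norm_sub_rev] at h5
    simp only [B₁, B₂]
    linarith
  rw [div_mul_eq_mul_div, le_div_iff₀ hc]
  have hB₁ : 0 ≤ B₁ := by positivity
  have hB₂ : 0 ≤ B₂ := by positivity
  have hmul : δ * ‖z - w‖ ≤ √δ * ‖z - w‖ := by gcongr
  have hs : 0 ≤ ‖z - w‖ ^ 2 := by positivity
  have hs' : 0 ≤ √δ * ‖z - w‖ := by positivity
  calc ncomp Ω₂ π₂ (f z) v * c = c * ncomp Ω₂ π₂ (f z) v := mul_comm _ _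
    _ ≤ fderiv ℝ ρ (g q) (fderiv ℂ g q a) * ncomp Ω₂ π₂ (f z) v :=
        mul_le_mul_of_nonneg_right hqc.le (ncomp_nonneg _ _ _ _)
    _ ≤ ‖a‖ * ‖complexify (fderiv ℝ ρ (g q)) (fderiv ℂ g q v)‖ := e₂
    _ ≤ ‖a‖ * ((M + B₁ + B₂) * normalGauge Ω₁ π₁ z w) := by
        gcongr
        refine hD.trans ?_
        rw [normalGauge, ← hδ]
        nlinarith [mul_nonneg hB₁ hn0, mul_nonneg hB₁ hs, mul_nonneg hB₂ hn0,
          mul_nonneg hM hs, mul_nonneg hM hs', mul_le_mul_of_nonneg_left hmul hB₁,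
          mul_le_mul_of_nonneg_left hmul hB₂]
    _ = _ := by ring

lemma IsBiholomorphicPair.exists_normalGauge_le {Ω₁ Ω₂ U₁ U₂ : Set (E N)} {f g : E N → E N}
    (h : IsBiholomorphicPair Ω₁ Ω₂ U₁ U₂ f g) (h1 : IsCkDomain 2 Ω₁) (hΩ₂ : IsOpen Ω₂)
    {π₁ π₂ : E N → E N} (hπ₁ : IsClosestPointSelection Ω₁ π₁)
    (hπ₂ : IsClosestPointSelection Ω₂ π₂) :
    ∃ C : ℝ, ∀ z ∈ Ω₁, ∀ w ∈ Ω₁,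
      normalGauge Ω₂ π₂ (f z) (f w) ≤ C * normalGauge Ω₁ π₁ z w := by
  obtain ⟨hΩ₁, -, hb, hbd⟩ := h1
  obtain ⟨L, hL⟩ := h.exists_lipschitzOnWith_closure hb
  have hfl : ∀ z ∈ Ω₁, ∀ w ∈ Ω₁, ‖f z - f w‖ ≤ L * ‖z - w‖ := fun z hz w hw => by
    simpa only [dist_eq_norm] using hL.dist_le_mul z (subset_closure hz) w (subset_closure hw)
  have hnl : ∀ z ∈ Ω₁, ∀ w ∈ Ω₁, ncomp Ω₂ π₂ (f z) (f z - f w) ≤ L * ‖z - w‖ := fun z hz w hw =>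
    (hπ₂.ncomp_le hΩ₂ (h.mem_right hz) _).trans (hfl z hz w hw)
  have hK : IsCompact (closure Ω₁ ×ˢ closure Ω₁) :=
    hb.isCompact_closure.prod hb.isCompact_closure
  have hloc : ∀ x ∈ closure Ω₁ ×ˢ closure Ω₁, ∃ C : ℝ, ∀ᶠ y in 𝓝 x, y ∈ Ω₁ ×ˢ Ω₁ →
      ncomp Ω₂ π₂ (f y.1) (f y.1 - f y.2) ≤ C * normalGauge Ω₁ π₁ y.1 y.2 := by
    rintro ⟨z, w⟩ ⟨hz, -⟩
    by_cases hzw : z = w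
    · subst hzw
      by_cases hzΩ : z ∈ Ω₁
      · have hδ : 0 < bdist Ω₁ z := hπ₁.bdist_pos hΩ₁ hzΩ
        have hcont : ContinuousAt (fun y : E N × E N => √(bdist Ω₁ y.1)) (z, z) :=
          (Real.continuous_sqrt.comp ((continuous_infDist_pt _).comp continuous_fst)).continuousAt
        have hs : 0 < √(bdist Ω₁ z) := Real.sqrt_pos.2 hδ
        refine ⟨L / (√(bdist Ω₁ z) / 2), ?_⟩
        filter_upwards [hcont.eventually_const_lt
          (show √(bdist Ω₁ z) / 2 < √(bdist Ω₁ z) by linarith)] with y hy hyΩ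
        refine (hnl _ hyΩ.1 _ hyΩ.2).trans ?_
        rw [div_mul_eq_mul_div, le_div_iff₀ (by positivity), mul_assoc]
        gcongr
        have := ncomp_nonneg Ω₁ π₁ y.1 (y.1 - y.2)
        rw [normalGauge, mul_comm]
        nlinarith [norm_nonneg (y.1 - y.2), sq_nonneg ‖y.1 - y.2‖]
      · have hzf : z ∈ frontier Ω₁ := by rw [hΩ₁.frontier_eq]; exact ⟨hz, hzΩ⟩
        obtain ⟨C, hC⟩ := exists_ncomp_le_of_mem_frontier h hΩ₁ hΩ₂ hπ₁ hπ₂ hL (hbd z hzf)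
        exact ⟨C, eventually_nhdsWithin_iff.1 hC⟩
    · have hd : 0 < ‖z - w‖ := norm_pos_iff.2 (sub_ne_zero.2 hzw)
      have hcont : ContinuousAt (fun y : E N × E N => ‖y.1 - y.2‖) (z, w) := by fun_prop
      refine ⟨L / (‖z - w‖ / 2), ?_⟩
      filter_upwards [hcont.eventually_const_lt
        (show ‖z - w‖ / 2 < ‖z - w‖ by linarith)] with y hy hyΩ
      refine (hnl _ hyΩ.1 _ hyΩ.2).trans ?_
      rw [div_mul_eq_mul_div, le_div_iff₀ (by positivity), mul_assoc]
      gcongr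
      have := ncomp_nonneg Ω₁ π₁ y.1 (y.1 - y.2)
      have h2 : 0 ≤ √(bdist Ω₁ y.1) * ‖y.1 - y.2‖ := by positivity
      rw [normalGauge]
      nlinarith [norm_nonneg (y.1 - y.2)]
  obtain ⟨C, hC⟩ : ∃ C : ℝ, ∀ y ∈ closure Ω₁ ×ˢ closure Ω₁, y ∈ Ω₁ ×ˢ Ω₁ →
      ncomp Ω₂ π₂ (f y.1) (f y.1 - f y.2) ≤ C * normalGauge Ω₁ π₁ y.1 y.2 := by
    refine hK.induction_on (p := fun s => ∃ C : ℝ, ∀ y ∈ s, y ∈ Ω₁ ×ˢ Ω₁ →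
      ncomp Ω₂ π₂ (f y.1) (f y.1 - f y.2) ≤ C * normalGauge Ω₁ π₁ y.1 y.2) ⟨0, by simp⟩
      (fun s t hst ⟨C, hC⟩ => ⟨C, fun y hy => hC y (hst hy)⟩) ?_ ?_
    · rintro s t ⟨C, hC⟩ ⟨C', hC'⟩
      refine ⟨max C C', fun y hy hyΩ => ?_⟩
      have h0 := normalGauge_nonneg Ω₁ π₁ y.1 y.2
      rcases hy with hy | hy
      · exact (hC y hy hyΩ).trans (by gcongr; exact le_max_left _ _)
      · exact (hC' y hy hyΩ).trans (by gcongr; exact le_max_right _ _)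
    · intro x hx
      obtain ⟨C, hC⟩ := hloc x hx
      exact ⟨_, mem_nhdsWithin_of_mem_nhds hC, C, fun y hy => hy⟩
  refine ⟨C + (L ^ 2 + √L * L), fun z hz w hw => ?_⟩
  have e1 := hC (z, w) ⟨subset_closure hz, subset_closure hw⟩ ⟨hz, hw⟩
  have e2 : ‖f z - f w‖ ^ 2 ≤ L ^ 2 * ‖z - w‖ ^ 2 := by
    rw [← mul_pow]
    gcongr
    exact hfl z hz w hw
  have e3 : √(bdist Ω₂ (f z)) * ‖f z - f w‖ ≤ √L * L * (√(bdist Ω₁ z) * ‖z - w‖) :=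
    calc √(bdist Ω₂ (f z)) * ‖f z - f w‖ ≤ √(L * bdist Ω₁ z) * (L * ‖z - w‖) := by
          gcongr
          · exact h.bdist_le hΩ₁ hΩ₂ hπ₁ hL hz
          · exact hfl z hz w hw
      _ = _ := by rw [Real.sqrt_mul (NNReal.coe_nonneg L)]; ring
  have h0 := ncomp_nonneg Ω₁ π₁ z (z - w)
  have h2 : 0 ≤ √(bdist Ω₁ z) * ‖z - w‖ := by positivity
  have hL2 : 0 ≤ (L : ℝ) ^ 2 := by positivity
  have hLL : 0 ≤ √(L : ℝ) * L := by positivity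
  rw [add_mul]
  have e4 : L ^ 2 * ‖z - w‖ ^ 2 + √L * L * (√(bdist Ω₁ z) * ‖z - w‖) ≤
      (L ^ 2 + √L * L) * normalGauge Ω₁ π₁ z w := by
    rw [normalGauge]
    nlinarith [mul_nonneg hL2 h0, mul_nonneg hL2 h2, mul_nonneg hLL h0,
      mul_nonneg hLL (sq_nonneg ‖z - w‖)]
  have e5 : normalGauge Ω₂ π₂ (f z) (f w) = ncomp Ω₂ π₂ (f z) (f z - f w) + ‖f z - f w‖ ^ 2 +
    √(bdist Ω₂ (f z)) * ‖f z - f w‖ := rfl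
  rw [e5]
  linarith

/-- Two-sided comparison of the quantity
`‖(z−w)_z‖ + ‖z−w‖² + δ^{1/2}(z)‖z−w‖` under a biholomorphism extending past the
closures. -/
theorem stmt12 {N : ℕ}
    (Ω₁ Ω₂ : Set (E N)) (h1 : IsCkDomain 2 Ω₁) (h2 : IsCkDomain 2 Ω₂)
    (U₁ U₂ : Set (E N)) (f g : E N → E N)
    (hU₁ : IsOpen U₁) (hU₂ : IsOpen U₂)
    (hcl₁ : closure Ω₁ ⊆ U₁) (hcl₂ : closure Ω₂ ⊆ U₂)
    (hf : DifferentiableOn ℂ f U₁) (hg : DifferentiableOn ℂ g U₂)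
    (hfU : Set.MapsTo f U₁ U₂) (hgU : Set.MapsTo g U₂ U₁)
    (hgf : ∀ x ∈ U₁, g (f x) = x) (hfg : ∀ y ∈ U₂, f (g y) = y)
    (him : f '' Ω₁ = Ω₂)
    (π₁ π₂ : E N → E N)
    (hπ₁ : IsClosestPointSelection Ω₁ π₁) (hπ₂ : IsClosestPointSelection Ω₂ π₂) :
    ∃ c C : ℝ, 0 < c ∧ c < C ∧ ∀ z ∈ Ω₁, ∀ w ∈ Ω₁, z ≠ w →
      c * (ncomp Ω₁ π₁ z (z - w) + ‖z - w‖ ^ 2 + Real.sqrt (bdist Ω₁ z) * ‖z - w‖) ≤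
        ncomp Ω₂ π₂ (f z) (f z - f w) + ‖f z - f w‖ ^ 2 +
          Real.sqrt (bdist Ω₂ (f z)) * ‖f z - f w‖ ∧
      ncomp Ω₂ π₂ (f z) (f z - f w) + ‖f z - f w‖ ^ 2 +
          Real.sqrt (bdist Ω₂ (f z)) * ‖f z - f w‖ ≤
        C * (ncomp Ω₁ π₁ z (z - w) + ‖z - w‖ ^ 2 + Real.sqrt (bdist Ω₁ z) * ‖z - w‖) := by
  have h : IsBiholomorphicPair Ω₁ Ω₂ U₁ U₂ f g :=
    ⟨hU₁, hU₂, hcl₁, hcl₂, hf, hg, hfU, hgU, hgf, hfg, him⟩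
  obtain ⟨C₁, hC₁⟩ := h.exists_normalGauge_le h1 h2.1 hπ₁ hπ₂
  obtain ⟨C₂, hC₂⟩ := h.symm.exists_normalGauge_le h2 h1.1 hπ₂ hπ₁
  have hpos : 0 < |C₂| + 1 := by positivity
  refine ⟨(|C₂| + 1)⁻¹, |C₁| + 2, by positivity, ?_, fun z hz w hw _ => ⟨?_, ?_⟩⟩
  · have : (|C₂| + 1)⁻¹ ≤ 1 := inv_le_one_of_one_le₀ (by linarith [abs_nonneg C₂])
    linarith [abs_nonneg C₁]
  · change (|C₂| + 1)⁻¹ * normalGauge Ω₁ π₁ z w ≤ normalGauge Ω₂ π₂ (f z) (f w)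
    have h3 := hC₂ (f z) (h.mem_right hz) (f w) (h.mem_right hw)
    rw [hgf z (hcl₁ (subset_closure hz)), hgf w (hcl₁ (subset_closure hw))] at h3
    rw [inv_mul_le_iff₀ hpos]
    refine h3.trans (mul_le_mul_of_nonneg_right ?_ (normalGauge_nonneg _ _ _ _))
    linarith [le_abs_self C₂]
  · refine (hC₁ z hz w hw).trans (mul_le_mul_of_nonneg_right ?_ (normalGauge_nonneg _ _ _ _))
    linarith [le_abs_self C₁]

end InvDist
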